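/- Let σ : ℝ → ℝ be L_σ-Lipschitz with σ(0) = 0 and applied entrywise to matrices. Let two GNN layers produce H^l = σ(S H^{l−1} W^{l−1} + H^{l−1} B^{l−1}) and Ĥ^l = σ(Ŝ Ĥ^{l−1} Ŵ^{l−1} + Ĥ^{l−1} B̂^{l−1}) from inputs H^{l−1}, Ĥ^{l−1} ∈ ℝ^{N×F}, with Ŝ = S + ΔS, Ŵ^{l−1} = W^{l−1} + ΔW^{l−1}, B̂^{l−1} = B^{l−1} + ΔB^{l−1}. Then, with ‖·‖ the Frobenius norm, ‖H^l − Ĥ^l‖ ≤ L_σ (‖S‖·‖W^{l−1}‖ + ‖B^{l−1}‖)·‖H^{l−1} − Ĥ^{l−1}‖ + L_σ (‖ΔS‖·‖ΔW^{l−1}‖ + ‖ΔS‖·‖W^{l−1}‖ + ‖ΔB^{l−1}‖ + ‖S‖·‖ΔW^{l−1}‖)·‖Ĥ^{l−1}‖. -/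

import Mathlib

/-- The Frobenius norm of a real matrix. -/
noncomputable def frob {N M : ℕ} (A : Matrix (Fin N) (Fin M) ℝ) : ℝ :=
  Real.sqrt (∑ i, ∑ j, (A i j) ^ 2)

section FrobeniusNorm

open scoped Matrix.Norms.Frobenius

theorem frob_eq_norm {N M : ℕ} (A : Matrix (Fin N) (Fin M) ℝ) : frob A = ‖A‖ := by
  simp [frob, Matrix.frobenius_norm_def, Real.sqrt_eq_rpow]

theorem frob_nonneg {N M : ℕ} (A : Matrix (Fin N) (Fin M) ℝ) : 0 ≤ frob A :=
  Real.sqrt_nonneg _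

theorem frob_add_le {N M : ℕ} (A B : Matrix (Fin N) (Fin M) ℝ) :
    frob (A + B) ≤ frob A + frob B := by
  simpa only [frob_eq_norm] using norm_add_le A B

theorem frob_sub_le {N M : ℕ} (A B : Matrix (Fin N) (Fin M) ℝ) :
    frob (A - B) ≤ frob A + frob B := by
  simpa only [frob_eq_norm] using norm_sub_le A B

theorem frob_mul_le {N M K : ℕ} (A : Matrix (Fin N) (Fin M) ℝ) (B : Matrix (Fin M) (Fin K) ℝ) :
    frob (A * B) ≤ frob A * frob B := by
  simpa only [frob_eq_norm] using Matrix.frobenius_norm_mul A B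

end FrobeniusNorm

theorem frob_mul_mul_le {N M K L : ℕ} (A : Matrix (Fin N) (Fin M) ℝ)
    (B : Matrix (Fin M) (Fin K) ℝ) (C : Matrix (Fin K) (Fin L) ℝ) :
    frob (A * B * C) ≤ frob A * frob B * frob C :=
  (frob_mul_le _ _).trans (mul_le_mul_of_nonneg_right (frob_mul_le _ _) (frob_nonneg _))

theorem frob_map_sub_map_le {N M : ℕ} {σ : ℝ → ℝ} {K : ℝ} (hK : 0 ≤ K)
    (hσ : ∀ a b : ℝ, |σ a - σ b| ≤ K * |a - b|) (A B : Matrix (Fin N) (Fin M) ℝ) :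
    frob (A.map σ - B.map σ) ≤ K * frob (A - B) := by
  unfold frob
  rw [← Real.sqrt_sq hK, ← Real.sqrt_mul (sq_nonneg K)]
  refine Real.sqrt_le_sqrt ?_
  simp_rw [Finset.mul_sum]
  refine Finset.sum_le_sum fun i _ => Finset.sum_le_sum fun j _ => ?_
  simpa only [Matrix.sub_apply, Matrix.map_apply, mul_pow, sq_abs] using
    pow_le_pow_left₀ (abs_nonneg _) (hσ (A i j) (B i j)) 2

/-- Single GNN-layer perturbation bound (after the entrywise
`L_σ`-Lipschitz activation `σ` with `σ 0 = 0`):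
`‖H^l − Ĥ^l‖ ≤ L_σ(‖S‖‖W‖ + ‖B‖)‖H^{l−1} − Ĥ^{l−1}‖
  + L_σ(‖ΔS‖‖ΔW‖ + ‖ΔS‖‖W‖ + ‖ΔB‖ + ‖S‖‖ΔW‖)‖Ĥ^{l−1}‖`. -/
theorem stmt5 {N F F' : ℕ}
    (σ : ℝ → ℝ) (Lσ : ℝ)
    (hσ : ∀ a b : ℝ, |σ a - σ b| ≤ Lσ * |a - b|) (hσ0 : σ 0 = 0)
    (S ΔS : Matrix (Fin N) (Fin N) ℝ)
    (Hprev Hhprev : Matrix (Fin N) (Fin F) ℝ)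
    (W ΔW B ΔB : Matrix (Fin F) (Fin F') ℝ)
    (Hl Hhl : Matrix (Fin N) (Fin F') ℝ)
    (hHl : Hl = (S * Hprev * W + Hprev * B).map σ)
    (hHhl : Hhl = ((S + ΔS) * Hhprev * (W + ΔW) + Hhprev * (B + ΔB)).map σ) :
    frob (Hl - Hhl) ≤
      Lσ * (frob S * frob W + frob B) * frob (Hprev - Hhprev) +
        Lσ * (frob ΔS * frob ΔW + frob ΔS * frob W + frob ΔB + frob S * frob ΔW) *
          frob Hhprev := by
  have hL : 0 ≤ Lσ := by simpa using (abs_nonneg _).trans (hσ 1 0)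
  subst hHl hHhl
  have hdecomp : S * Hprev * W + Hprev * B
        - ((S + ΔS) * Hhprev * (W + ΔW) + Hhprev * (B + ΔB)) =
      (S * (Hprev - Hhprev) * W + (Hprev - Hhprev) * B) -
        (ΔS * Hhprev * ΔW + ΔS * Hhprev * W + Hhprev * ΔB + S * Hhprev * ΔW) := by
    simp only [Matrix.add_mul, Matrix.mul_add, Matrix.sub_mul, Matrix.mul_sub]
    abel
  refine (frob_map_sub_map_le hL hσ _ _).trans ?_
  rw [hdecomp, mul_assoc, mul_assoc, ← mul_add]
  refine mul_le_mul_of_nonneg_left ?_ hL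
  calc
    _ ≤ frob (S * (Hprev - Hhprev) * W) + frob ((Hprev - Hhprev) * B) +
        (frob (ΔS * Hhprev * ΔW) + frob (ΔS * Hhprev * W) + frob (Hhprev * ΔB) +
          frob (S * Hhprev * ΔW)) := by
      refine (frob_sub_le _ _).trans (add_le_add (frob_add_le _ _) ?_)
      refine (frob_add_le _ _).trans ?_
      gcongr
      refine (frob_add_le _ _).trans ?_
      gcongr
      exact frob_add_le _ _
    _ ≤ frob S * frob (Hprev - Hhprev) * frob W + frob (Hprev - Hhprev) * frob B +
        (frob ΔS * frob Hhprev * frob ΔW + frob ΔS * frob Hhprev * frob W +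
          frob Hhprev * frob ΔB + frob S * frob Hhprev * frob ΔW) := by
      have h₁ := frob_mul_mul_le S (Hprev - Hhprev) W
      have h₂ := frob_mul_le (Hprev - Hhprev) B
      have h₃ := frob_mul_mul_le ΔS Hhprev ΔW
      have h₄ := frob_mul_mul_le ΔS Hhprev W
      have h₅ := frob_mul_le Hhprev ΔB
      have h₆ := frob_mul_mul_le S Hhprev ΔW
      linarith
    _ = _ := by ring
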